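/- For all integers k, m with 3 ≤ k ≤ m and every integer n with n ≥ 4 and m ≤ n, there exist n×n real symmetric matrices A, B with min{rank(A), rank(B)} = k and max{rank(A), rank(B)} = m, and a skew-symmetric matrix W₀ ∈ Kⁿ with ‖W₀‖_F = 1, such that for every symmetric matrix U ∈ Sⁿ with ‖U‖_F = 1 one has trace(A·W₀·B·W₀ᵀ) < trace(A·U·B·U); in particular the weak interlacing property fails for (A,B). -/

import Mathlib

open Matrix

noncomputable def frobNorm {n : ℕ} (M : Matrix (Fin n) (Fin n) ℝ) : ℝ :=
  Real.sqrt (Mᵀ * M).trace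

def Eset {n : ℕ} (A B : Matrix (Fin n) (Fin n) ℝ) : Set ℝ :=
  {t | ∃ U : Matrix (Fin n) (Fin n) ℝ, Uᵀ = U ∧ frobNorm U = 1 ∧ t = (A * U * B * U).trace}

def Oset {n : ℕ} (A B : Matrix (Fin n) (Fin n) ℝ) : Set ℝ :=
  {t | ∃ W : Matrix (Fin n) (Fin n) ℝ, Wᵀ = -W ∧ frobNorm W = 1 ∧ t = (A * W * B * Wᵀ).trace}

namespace WeakInterlacing

variable {r : ℕ}

/-- The `4 × 4` core of the first matrix; it has rank `3` for `s = 0` and rank `4` otherwise. -/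
def coreA (s : ℝ) : Matrix (Fin 4) (Fin 4) ℝ :=
  !![s, 1, 0, 0; 1, 0, 1, 0; 0, 1, 0, 0; 0, 0, 0, 2]

/-- The `4 × 4` core of the second matrix; it has rank `3` for `t = 0` and rank `4` otherwise. -/
def coreB (t : ℝ) : Matrix (Fin 4) (Fin 4) ℝ :=
  !![-2, 0, 0, 0; 0, 0, 1, 0; 0, 1, 0, 1; 0, 0, 1, t]

/-- A skew-symmetric matrix of squared Frobenius norm `76`, close to a minimizer. -/
def coreW : Matrix (Fin 4) (Fin 4) ℝ :=
  !![0, 1, 1, 5; -1, 0, -3, -1; -1, 3, 0, 1; -5, 1, -1, 0]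

theorem coreA_transpose (s : ℝ) : (coreA s)ᵀ = coreA s := by
  ext i j; fin_cases i <;> fin_cases j <;> rfl

theorem coreB_transpose (t : ℝ) : (coreB t)ᵀ = coreB t := by
  ext i j; fin_cases i <;> fin_cases j <;> rfl

theorem coreW_transpose : coreWᵀ = -coreW := by
  ext i j; fin_cases i <;> fin_cases j <;> simp [coreW]

theorem trace_coreW_sq : (coreWᵀ * coreW).trace = 76 := by
  simp [coreW, trace, Fin.sum_univ_four, mul_apply]
  norm_num

theorem trace_coreW_lt {s t : ℝ} (hs' : s ≤ 1 / 100) (ht : 0 ≤ t)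
    (ht' : t ≤ 1 / 100) :
    (coreA s * coreW * coreB t * coreWᵀ).trace < -(11 / 5) * 76 := by
  have h : (coreA s * coreW * coreB t * coreWᵀ).trace = -170 + 12 * s - 12 * t + 25 * (s * t) := by
    rw [coreW_transpose]
    simp [coreA, coreB, coreW, trace, Fin.sum_univ_four]
    ring
  rw [h]
  nlinarith [mul_le_mul hs' ht' ht (by norm_num)]

/-- The form `U ↦ trace (A U B U)` on symmetric `4 × 4` matrices is bounded below by
`-11/5` times the squared Frobenius norm. -/
theorem core_trace_lower {s t : ℝ} (hs : 0 ≤ s) (hs' : s ≤ 1 / 100) (ht : 0 ≤ t)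
    (ht' : t ≤ 1 / 100) (X : Matrix (Fin 4) (Fin 4) ℝ) (hX : Xᵀ = X) :
    -(11 / 5) * (Xᵀ * X).trace ≤ (coreA s * X * coreB t * X).trace := by
  have hsymm : ∀ i j, X j i = X i j := fun i j => congrFun (congrFun hX i) j
  have h10 := hsymm 0 1
  have h20 := hsymm 0 2
  have h30 := hsymm 0 3
  have h21 := hsymm 1 2
  have h31 := hsymm 1 3
  have h32 := hsymm 2 3
  rw [hX]
  simp only [coreA, coreB, trace, Fin.sum_univ_four, mul_apply, diag_apply, of_apply, cons_val,
    h10, h20, h30, h21, h31, h32]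
  generalize X 0 0 = x00
  generalize X 0 1 = x01
  generalize X 0 2 = x02
  generalize X 0 3 = x03
  generalize X 1 1 = x11
  generalize X 1 2 = x12
  generalize X 1 3 = x13
  generalize X 2 2 = x22
  generalize X 2 3 = x23
  generalize X 3 3 = x33
  have hbase : 0 ≤ 43 / 20 * (x00 - 40 / 43 * x01) ^ 2 +
      3 / 10 * (x03 + 10 / 3 * x12) ^ 2 +
      43 / 20 * (x33 + 40 / 43 * x23) ^ 2 +
      1049 / 430 * (x01 - 860 / 1049 * x02 + 430 / 1049 * x12) ^ 2 +
      43 / 20 * (x11 + 20 / 43 * x02 + 20 / 43 * x22) ^ 2 +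
      80461 / 31470 * (x12 + 25800 / 80461 * x02 + 31470 / 80461 * x23) ^ 2 +
      1449 / 860 * (x22 - 400 / 1449 * x02 + 860 / 1449 * x13) ^ 2 +
      2103189727 / 1165879890 * (x02 + 34598230 / 48911389 * x13 - 8694000 / 48911389 * x23) ^ 2 +
      1371402827 / 489113890 * (x13 + 1089167780 / 1371402827 * x23) ^ 2 +
      3056571861 / 13714028270 * (x23) ^ 2 := by positivity
  have hsterm : 0 ≤ s * ((x01 + x02) ^ 2 + (x02 + x03) ^ 2 + x01 ^ 2 + x03 ^ 2) := by positivity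
  have htterm : 0 ≤ t * ((x03 + x13) ^ 2 + (x13 + x23) ^ 2 + x03 ^ 2 + x23 ^ 2 + 2 * x33 ^ 2) := by
    positivity
  have hst : 0 ≤ s * t * x03 ^ 2 := by positivity
  have hs2 : 0 ≤ (1 / 100 - s) * (2 * (x00 ^ 2 + x01 ^ 2 + x02 ^ 2 + x03 ^ 2)) :=
    mul_nonneg (by linarith) (by positivity)
  have ht2 : 0 ≤ (1 / 100 - t) * (2 * (x03 ^ 2 + x13 ^ 2 + x23 ^ 2)) :=
    mul_nonneg (by linarith) (by positivity)
  have h00 := sq_nonneg x00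
  have h01 := sq_nonneg x01
  have h02 := sq_nonneg x02
  have h03 := sq_nonneg x03
  have h11 := sq_nonneg x11
  have h12 := sq_nonneg x12
  have h13 := sq_nonneg x13
  have h22 := sq_nonneg x22
  have h23 := sq_nonneg x23
  have h33 := sq_nonneg x33
  linarith

theorem dotProduct_self_nonneg_real {p : Type*} [Fintype p] (v : p → ℝ) : 0 ≤ v ⬝ᵥ v :=
  Finset.sum_nonneg fun i _ => mul_self_nonneg (v i)

theorem trace_fromBlocks_eq_add {p q : Type*} [Fintype p] [Fintype q] (M : Matrix p p ℝ)
    (N : Matrix p q ℝ) (N' : Matrix q p ℝ) (M' : Matrix q q ℝ) :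
    (fromBlocks M N N' M').trace = M.trace + M'.trace := by
  simp [trace]

theorem sum_weighted_lower {M : Matrix (Fin 4) (Fin 4) ℝ} (hM : ∀ y : Fin 4 → ℝ,
      -2 * (y ⬝ᵥ y) ≤ y ⬝ᵥ M *ᵥ y) (d : Fin r → ℝ) (hd : ∀ i, 0 ≤ d i) (hd' : ∀ i, d i ≤ 1 / 100)
    (Y : Matrix (Fin 4) (Fin r) ℝ) :
    -(1 / 50) * (Yᵀ * Y).trace ≤ (M * Y * diagonal d * Yᵀ).trace := by
  have hsum : (M * Y * diagonal d * Yᵀ).trace =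
      ∑ j, d j * ((fun i => Y i j) ⬝ᵥ M *ᵥ fun i => Y i j) := by
    rw [trace_mul_comm, ← Matrix.mul_assoc, trace]
    refine Finset.sum_congr rfl fun j _ => ?_
    rw [diag_apply, mul_diagonal, mul_comm]
    rfl
  rw [hsum, trace, Finset.mul_sum]
  refine Finset.sum_le_sum fun j _ => ?_
  have h1 : (Yᵀ * Y).diag j = (fun i => Y i j) ⬝ᵥ fun i => Y i j := rfl
  have h2 : 0 ≤ (fun i => Y i j) ⬝ᵥ fun i => Y i j := dotProduct_self_nonneg_real _
  have h3 := mul_le_mul_of_nonneg_left (hM fun i => Y i j) (hd j)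
  rw [h1]
  nlinarith [mul_le_mul_of_nonneg_right (hd' j) h2]

theorem coreA_form_lower {s : ℝ} (hs : 0 ≤ s) (y : Fin 4 → ℝ) :
    -2 * (y ⬝ᵥ y) ≤ y ⬝ᵥ coreA s *ᵥ y := by
  simp [coreA, dotProduct, mulVec, Fin.sum_univ_four]
  nlinarith [sq_nonneg (y 0 + y 1), sq_nonneg (y 1 + y 2), mul_nonneg hs (sq_nonneg (y 0)),
    sq_nonneg (y 0), sq_nonneg (y 2), sq_nonneg (y 3)]

theorem coreB_form_lower {t : ℝ} (ht : 0 ≤ t) (y : Fin 4 → ℝ) :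
    -2 * (y ⬝ᵥ y) ≤ y ⬝ᵥ coreB t *ᵥ y := by
  simp [coreB, dotProduct, mulVec, Fin.sum_univ_four]
  nlinarith [sq_nonneg (y 1 + y 2), sq_nonneg (y 2 + y 3), mul_nonneg ht (sq_nonneg (y 3)),
    sq_nonneg (y 1), sq_nonneg (y 3)]

theorem trace_diagonal_mul_diagonal_nonneg {a b : Fin r → ℝ} (ha : ∀ i, 0 ≤ a i)
    (hb : ∀ i, 0 ≤ b i) (Z : Matrix (Fin r) (Fin r) ℝ) :
    0 ≤ (diagonal a * Z * diagonal b * Zᵀ).trace := by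
  refine Finset.sum_nonneg fun i _ => ?_
  rw [diag_apply, mul_apply]
  refine Finset.sum_nonneg fun j _ => ?_
  rw [mul_diagonal, diagonal_mul, transpose_apply]
  have : a i * Z i j * b j * Z i j = a i * b j * (Z i j) ^ 2 := by ring
  rw [this]
  exact mul_nonneg (mul_nonneg (ha i) (hb j)) (sq_nonneg _)

theorem trace_transpose_mul_self_nonneg {p q : Type*} [Fintype p] [Fintype q] (M : Matrix p q ℝ) :
    0 ≤ (Mᵀ * M).trace :=
  Finset.sum_nonneg fun _ _ => dotProduct_self_nonneg_real _

theorem block_trace_lower {s t : ℝ} (hs : 0 ≤ s) (hs' : s ≤ 1 / 100) (ht : 0 ≤ t)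
    (ht' : t ≤ 1 / 100) {a b : Fin r → ℝ} (ha : ∀ i, 0 ≤ a i) (ha' : ∀ i, a i ≤ 1 / 100)
    (hb : ∀ i, 0 ≤ b i) (hb' : ∀ i, b i ≤ 1 / 100)
    (U : Matrix (Fin 4 ⊕ Fin r) (Fin 4 ⊕ Fin r) ℝ) (hU : Uᵀ = U) :
    -(11 / 5) * (Uᵀ * U).trace ≤
      (fromBlocks (coreA s) 0 0 (diagonal a) * U * fromBlocks (coreB t) 0 0 (diagonal b) *
        U).trace := by
  obtain ⟨X, Y, Y', Z, rfl⟩ : ∃ X Y Y' Z, U = fromBlocks X Y Y' Z :=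
    ⟨_, _, _, _, (fromBlocks_toBlocks U).symm⟩
  rw [fromBlocks_transpose, fromBlocks_inj] at hU
  obtain ⟨hX, -, rfl, hZ⟩ := hU
  have h1 := core_trace_lower hs hs' ht ht' X hX
  have h2 := sum_weighted_lower (coreA_form_lower hs) b hb hb' Y
  have h3 := sum_weighted_lower (coreB_form_lower ht) a ha ha' Y
  have h4 := trace_diagonal_mul_diagonal_nonneg ha hb Z
  have h5 : (diagonal a * Yᵀ * coreB t * Y).trace = (coreB t * Y * diagonal a * Yᵀ).trace := by
    rw [Matrix.mul_assoc, trace_mul_comm, ← Matrix.mul_assoc]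
  have h6 : (Y * Yᵀ).trace = (Yᵀ * Y).trace := trace_mul_comm _ _
  have h7 := trace_transpose_mul_self_nonneg Y
  have h8 := trace_transpose_mul_self_nonneg Z
  rw [hZ] at h4
  simp only [fromBlocks_transpose, fromBlocks_multiply, trace_fromBlocks_eq_add, transpose_transpose,
    trace_add, Matrix.mul_zero, Matrix.zero_mul, add_zero, zero_add]
  linarith

theorem card_weight_ne_zero {k : ℕ} (hk : 3 ≤ k) (hkr : k ≤ 4 + r) (e : Fin 4 → ℝ) (d : Fin r → ℝ)
    (p : Fin 4) (hp : ∀ i ≠ p, e i ≠ 0) (hpk : e p = if 3 < k then 1 / 100 else 0)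
    (hd : d = fun i : Fin r => if (i : ℕ) < k - 4 then 1 / 100 else 0) :
    Fintype.card {i : Fin 4 ⊕ Fin r // Sum.elim e d i ≠ 0} = k := by
  classical
  have he : (Finset.univ.filter fun i => e i ≠ 0).card = if 3 < k then 4 else 3 := by
    split_ifs at hpk ⊢ with h
    · rw [Finset.filter_true_of_mem]
      · simp
      · intro i _
        by_cases hi : i = p
        · rw [hi, hpk]; norm_num
        · exact hp i hi
    · have : (Finset.univ.filter fun i => e i ≠ 0) = Finset.univ.erase p := by
        ext i
        by_cases hi : i = p
        · simp [hi, hpk]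
        · simp [hi, hp i hi]
      rw [this]; simp
  have hd' : (Finset.univ.filter fun i => d i ≠ 0).card = k - 4 := by
    have : (Finset.univ.filter fun i => d i ≠ 0) =
        Finset.univ.filter fun i : Fin r => (i : ℕ) < k - 4 := by
      ext i
      simp only [hd, Finset.mem_filter, Finset.mem_univ, true_and]
      split_ifs with h <;> simp [h]
    rw [this, Fin.card_filter_val_lt]
    omega
  have hequiv : {i : Fin 4 ⊕ Fin r // Sum.elim e d i ≠ 0} ≃ {i // e i ≠ 0} ⊕ {i // d i ≠ 0} :=
    Equiv.subtypeSum
  rw [Fintype.card_congr hequiv, Fintype.card_sum, Fintype.card_subtype, Fintype.card_subtype,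
    he, hd']
  split_ifs <;> omega

theorem rank_fromBlocks_of_factorization {M L R : Matrix (Fin 4) (Fin 4) ℝ} {e : Fin 4 → ℝ}
    (hM : M = L * diagonal e * R) (hL : IsUnit L.det) (hR : IsUnit R.det) (d : Fin r → ℝ) :
    (fromBlocks M 0 0 (diagonal d)).rank =
      Fintype.card {i : Fin 4 ⊕ Fin r // Sum.elim e d i ≠ 0} := by
  have h : fromBlocks M 0 0 (diagonal d) =
      fromBlocks L 0 0 1 * diagonal (Sum.elim e d) * fromBlocks R 0 0 1 := by
    rw [← fromBlocks_diagonal, fromBlocks_multiply, fromBlocks_multiply, hM]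
    simp
  rw [h, rank_mul_eq_left_of_isUnit_det, rank_mul_eq_right_of_isUnit_det, rank_diagonal]
  · simpa using hL
  · simpa using hR

theorem coreA_factorization (s : ℝ) :
    coreA s = !![1, 0, 1, 0; 0, 1, 0, 0; 0, 0, 1, 0; 0, 0, 0, 1] * diagonal ![s, 1, 1, 2] *
      !![1, 0, 0, 0; 1, 0, 1, 0; 0, 1, 0, 0; 0, 0, 0, 1] := by
  ext i j
  fin_cases i <;> fin_cases j <;> simp [coreA, mul_apply, Fin.sum_univ_four, vecMul_diagonal]

theorem coreB_factorization (t : ℝ) :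
    coreB t = !![1, 0, 0, 0; 0, 1, 0, 0; 0, 0, 1, 0; 0, 1, 0, 1] * diagonal ![-2, 1, 1, t] *
      !![1, 0, 0, 0; 0, 0, 1, 0; 0, 1, 0, 1; 0, 0, 0, 1] := by
  ext i j
  fin_cases i <;> fin_cases j <;> simp [coreB, mul_apply, Fin.sum_univ_four, vecMul_diagonal]

theorem rank_block_coreA {k : ℕ} (hk : 3 ≤ k) (hkr : k ≤ 4 + r) :
    (fromBlocks (coreA (if 3 < k then 1 / 100 else 0)) 0 0
      (diagonal fun i : Fin r => if (i : ℕ) < k - 4 then (1 / 100 : ℝ) else 0)).rank = k := by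
  rw [rank_fromBlocks_of_factorization (coreA_factorization _)]
  · refine card_weight_ne_zero hk hkr _ _ 0 ?_ rfl rfl
    intro i hi
    fin_cases i <;> simp at hi ⊢
  · simp [det_succ_row_zero, Fin.sum_univ_succ, Fin.succAbove]
  · simp [det_succ_row_zero, Fin.sum_univ_succ, Fin.succAbove]

theorem rank_block_coreB {k : ℕ} (hk : 3 ≤ k) (hkr : k ≤ 4 + r) :
    (fromBlocks (coreB (if 3 < k then 1 / 100 else 0)) 0 0
      (diagonal fun i : Fin r => if (i : ℕ) < k - 4 then (1 / 100 : ℝ) else 0)).rank = k := by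
  rw [rank_fromBlocks_of_factorization (coreB_factorization _)]
  · refine card_weight_ne_zero hk hkr _ _ 3 ?_ rfl rfl
    intro i hi
    fin_cases i <;> simp at hi ⊢
  · simp [det_succ_row_zero, Fin.sum_univ_succ, Fin.succAbove]
  · simp [det_succ_row_zero, Fin.sum_univ_succ, Fin.succAbove]

theorem trace_submatrix_equiv {p q : Type*} [Fintype p] [Fintype q] (M : Matrix p p ℝ) (e : q ≃ p) :
    (M.submatrix e e).trace = M.trace :=
  e.sum_comp fun i => M i i

theorem frobNorm_eq_one_iff {n : ℕ} (M : Matrix (Fin n) (Fin n) ℝ) :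
    frobNorm M = 1 ↔ (Mᵀ * M).trace = 1 := by
  rw [frobNorm, Real.sqrt_eq_one]

theorem bddBelow_Oset {n : ℕ} (A B : Matrix (Fin n) (Fin n) ℝ) : BddBelow (Oset A B) := by
  refine ⟨-∑ i, ∑ l, ∑ k, ∑ j, |A i j| * |B k l|, ?_⟩
  rintro _ ⟨W, -, hW, rfl⟩
  rw [frobNorm_eq_one_iff] at hW
  have hent : ∀ i j, |W i j| ≤ 1 := by
    intro i j
    rw [← sq_le_one_iff_abs_le_one, ← hW]
    have h1 : (W i j) ^ 2 ≤ (Wᵀ * W).diag j := by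
      rw [diag_apply, mul_apply, sq]
      exact Finset.single_le_sum (f := fun x => Wᵀ j x * W x j)
        (fun x _ => mul_self_nonneg (W x j)) (Finset.mem_univ i)
    exact h1.trans (Finset.single_le_sum (f := fun x => (Wᵀ * W).diag x)
      (fun x _ => dotProduct_self_nonneg_real fun i => W i x) (Finset.mem_univ j))
  simp only [trace, diag_apply, mul_apply, Finset.sum_mul, ← Finset.sum_neg_distrib]
  refine Finset.sum_le_sum fun i _ => Finset.sum_le_sum fun l _ => Finset.sum_le_sum fun k _ =>
    Finset.sum_le_sum fun j _ => ?_
  refine le_trans (neg_le_neg ?_) (neg_abs_le _)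
  rw [transpose_apply, abs_mul, abs_mul, abs_mul]
  have h1 : |W j k| * |W i l| ≤ 1 := mul_le_one₀ (hent j k) (abs_nonneg _) (hent i l)
  calc |A i j| * |W j k| * |B k l| * |W i l| = |A i j| * |B k l| * (|W j k| * |W i l|) := by ring
    _ ≤ |A i j| * |B k l| * 1 := by gcongr
    _ = _ := mul_one _

theorem Eset_nonempty {n : ℕ} (hn : 0 < n) (A B : Matrix (Fin n) (Fin n) ℝ) :
    (Eset A B).Nonempty := by
  refine ⟨_, diagonal (Pi.single ⟨0, hn⟩ 1), diagonal_transpose _, ?_, rfl⟩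
  rw [frobNorm_eq_one_iff, diagonal_transpose, diagonal_mul_diagonal, trace_diagonal]
  simp [Pi.single_apply]

/-- A uniform gap between a value in `Oset` and all values in `Eset` refutes interlacing. -/
theorem not_interlacing_of_gap {n : ℕ} (hn : 0 < n) {A B : Matrix (Fin n) (Fin n) ℝ} {c v : ℝ}
    (hv : v ∈ Oset A B) (hvc : v < c) (hc : ∀ x ∈ Eset A B, c ≤ x) :
    ¬ (sInf (Eset A B) ≤ sInf (Oset A B) ∧ sSup (Oset A B) ≤ sSup (Eset A B)) := fun h =>
  absurd ((le_csInf (Eset_nonempty hn A B) hc).trans (h.1.trans (csInf_le (bddBelow_Oset A B) hv)))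
    (not_le.mpr hvc)

end WeakInterlacing

open WeakInterlacing

theorem stmt_15 (k m n : ℕ) (hk : 3 ≤ k) (hkm : k ≤ m) (hn4 : 4 ≤ n) (hmn : m ≤ n) :
    ∃ A B W₀ : Matrix (Fin n) (Fin n) ℝ,
      Aᵀ = A ∧ Bᵀ = B ∧
      min A.rank B.rank = k ∧ max A.rank B.rank = m ∧
      W₀ᵀ = -W₀ ∧ frobNorm W₀ = 1 ∧
      (∀ U : Matrix (Fin n) (Fin n) ℝ, Uᵀ = U → frobNorm U = 1 →
        (A * W₀ * B * W₀ᵀ).trace < (A * U * B * U).trace) ∧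
      ¬ (sInf (Eset A B) ≤ sInf (Oset A B) ∧ sSup (Oset A B) ≤ sSup (Eset A B)) := by
  obtain ⟨r, rfl⟩ := Nat.exists_eq_add_of_le hn4
  have hk4 : k ≤ 4 + r := hkm.trans hmn
  have hif : ∀ (P : Prop) [Decidable P], 0 ≤ (if P then 1 / 100 else 0 : ℝ) ∧
      (if P then 1 / 100 else 0 : ℝ) ≤ 1 / 100 := by
    intro P _
    split_ifs <;> norm_num
  set s : ℝ := if 3 < m then 1 / 100 else 0
  set t : ℝ := if 3 < k then 1 / 100 else 0
  set a : Fin r → ℝ := fun i => if (i : ℕ) < m - 4 then 1 / 100 else 0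
  set b : Fin r → ℝ := fun i => if (i : ℕ) < k - 4 then 1 / 100 else 0
  let e : Fin (4 + r) ≃ Fin 4 ⊕ Fin r := finSumFinEquiv.symm
  let A := (fromBlocks (coreA s) 0 0 (diagonal a)).submatrix e e
  let B := (fromBlocks (coreB t) 0 0 (diagonal b)).submatrix e e
  let W := (fromBlocks ((√76)⁻¹ • coreW) 0 0 (0 : Matrix (Fin r) (Fin r) ℝ)).submatrix e e
  have hrA : A.rank = m := (rank_submatrix _ e e).trans (rank_block_coreA (hk.trans hkm) hmn)
  have hrB : B.rank = k := (rank_submatrix _ e e).trans (rank_block_coreB hk hk4)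
  have hsq : (√76 : ℝ)⁻¹ * (√76)⁻¹ = 1 / 76 := by
    rw [← mul_inv, Real.mul_self_sqrt (by norm_num), one_div]
  have hWskew : Wᵀ = -W := by
    rw [transpose_submatrix, fromBlocks_transpose, transpose_smul, coreW_transpose, smul_neg]
    change _ = (-fromBlocks ((√76)⁻¹ • coreW) 0 0 (0 : Matrix (Fin r) (Fin r) ℝ)).submatrix e e
    rw [fromBlocks_neg]
    simp
  have hWnorm : frobNorm W = 1 := by
    rw [frobNorm_eq_one_iff]
    simp only [W, transpose_submatrix, submatrix_mul_equiv, trace_submatrix_equiv, transpose_smul,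
      Matrix.smul_mul, Matrix.mul_smul, smul_smul, hsq, trace_smul, fromBlocks_transpose,
      fromBlocks_multiply,
      trace_fromBlocks_eq_add, Matrix.mul_zero, Matrix.zero_mul, add_zero, transpose_zero, trace_zero,
      trace_coreW_sq, smul_eq_mul]
    norm_num
  have hWval : (A * W * B * Wᵀ).trace < -(11 / 5) := by
    have h := trace_coreW_lt (hif (3 < m)).2 (hif (3 < k)).1 (hif (3 < k)).2
    simp only [A, B, W, transpose_submatrix, submatrix_mul_equiv, trace_submatrix_equiv,
      transpose_smul, Matrix.smul_mul, Matrix.mul_smul, smul_smul, hsq, trace_smul, fromBlocks_transpose,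
      fromBlocks_multiply, trace_fromBlocks_eq_add, Matrix.mul_zero, Matrix.zero_mul, add_zero,
      transpose_zero, trace_zero, smul_eq_mul]
    linarith
  have hUval : ∀ U : Matrix (Fin (4 + r)) (Fin (4 + r)) ℝ, Uᵀ = U → frobNorm U = 1 →
      -(11 / 5) ≤ (A * U * B * U).trace := by
    intro U hU hU1
    rw [frobNorm_eq_one_iff] at hU1
    obtain ⟨V, rfl⟩ : ∃ V : Matrix (Fin 4 ⊕ Fin r) (Fin 4 ⊕ Fin r) ℝ, U = V.submatrix e e :=
      ⟨U.submatrix e.symm e.symm, by simp⟩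
    have hV : Vᵀ = V := by
      rw [transpose_submatrix] at hU
      simpa using congrArg (fun M => M.submatrix e.symm e.symm) hU
    have h := block_trace_lower (hif (3 < m)).1 (hif (3 < m)).2 (hif (3 < k)).1 (hif (3 < k)).2
      (a := a) (b := b) (fun _ => (hif _).1) (fun _ => (hif _).2) (fun _ => (hif _).1)
      (fun _ => (hif _).2) V hV
    simp only [A, B, transpose_submatrix, submatrix_mul_equiv, trace_submatrix_equiv] at hU1 ⊢
    rw [hU1] at h
    linarith
  refine ⟨A, B, W, ?_, ?_, ?_, ?_, hWskew, hWnorm,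
    fun U hU hU1 => hWval.trans_le (hUval U hU hU1),
    not_interlacing_of_gap (by omega) ⟨W, hWskew, hWnorm, rfl⟩ hWval ?_⟩
  · simp [A, transpose_submatrix, fromBlocks_transpose, coreA_transpose]
  · simp [B, transpose_submatrix, fromBlocks_transpose, coreB_transpose]
  · rw [hrA, hrB, min_eq_right hkm]
  · rw [hrA, hrB, max_eq_left hkm]
  · rintro _ ⟨U, hU, hU1, rfl⟩
    exact hUval U hU hU1
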